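/- Let R be a commutative ring, q ∈ R a unit, A an associative unital R-algebra, and m ≥ 2. Suppose α, β, γ, δ ∈ A satisfy the RE relations, and for l = 1, ..., m−1 the quadruples (a_l, b_l, c_l, d_l) each satisfy the GL_q(2) relations; elements of quadruples with different indices commute with each other, and every a_l, b_l, c_l, d_l commutes with each of α, β, γ, δ. For 2 ≤ k ≤ m define K^(k) = T_{k−1} ⋯ T_1 · K · T_1ᵗ ⋯ T_{k−1}ᵗ (a 2×2 matrix over A, with T_l = [[a_l,b_l],[c_l,d_l]], T_lᵗ = [[a_l,c_l],[b_l,d_l]], K = [[α,β],[γ,δ]]) and set c1^(k) = β^(k) − q γ^(k) and c2^(k) = α^(k) δ^(k) − q² β^(k) γ^(k), where α^(k), β^(k), γ^(k), δ^(k) are the entries of K^(k). Then: the elements c1^(k), c2^(p) (2 ≤ k, p ≤ m) pairwise commute, and each of them commutes with each of the four entries α^(m), β^(m), γ^(m), δ^(m) of K^(m). Consequently, every element of the subalgebra generated by α^(m), β^(m), γ^(m), δ^(m) commutes with all the c1^(k) and c2^(p). -/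

import Mathlib

/-- Elements `α β γ δ` of an associative unital `R`-algebra satisfy the
Reflection Equation (RE) relations (with parameter the unit `q`). -/
def REREl {R A : Type} [CommRing R] [Ring A] [Algebra R A] (q : Rˣ)
    (α β γ δ : A) : Prop :=
  α * β - β * α = ((q : R) - ((q⁻¹ : Rˣ) : R)) • (α * γ) ∧
  α * γ = ((q : R) ^ 2) • (γ * α) ∧
  α * δ - δ * α = ((q : R) - ((q⁻¹ : Rˣ) : R)) • (((q : R) • β + γ) * γ) ∧
  β * γ = γ * β ∧
  β * δ - δ * β = ((q : R) - ((q⁻¹ : Rˣ) : R)) • (γ * δ) ∧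
  γ * δ = ((q : R) ^ 2) • (δ * γ)

/-- Elements `a b c d` satisfy the `GL_q(2)` relations. -/
def GLq2Rel {R A : Type} [CommRing R] [Ring A] [Algebra R A] (q : Rˣ)
    (a b c d : A) : Prop :=
  a * b = (q : R) • (b * a) ∧
  a * c = (q : R) • (c * a) ∧
  b * d = (q : R) • (d * b) ∧
  c * d = (q : R) • (d * c) ∧
  b * c = c * b ∧
  a * d - d * a = ((q : R) - ((q⁻¹ : Rˣ) : R)) • (b * c)

/-- The matrix `T_l = [[a_l, b_l],[c_l, d_l]]`. -/
def Tmat {A : Type} [Ring A] (a b c d : ℕ → A) (l : ℕ) : Matrix (Fin 2) (Fin 2) A :=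
  !![a l, b l; c l, d l]

/-- The iterated coaction image: `KIter K a b c d j = T_j ⋯ T_1 ⬝ K ⬝ T_1ᵗ ⋯ T_jᵗ`,
so that `K^(k) = KIter K a b c d (k-1)`. -/
def KIter {A : Type} [Ring A] (K : Matrix (Fin 2) (Fin 2) A) (a b c d : ℕ → A) :
    ℕ → Matrix (Fin 2) (Fin 2) A
  | 0 => K
  | j + 1 => Tmat a b c d (j + 1) * KIter K a b c d j * (Tmat a b c d (j + 1)).transpose

theorem mul_mul_eq_of_mul_eq {M : Type*} [Semigroup M] {x y z : M} (h : x * y = z) (w : M) :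
    x * (y * w) = z * w := by
  rw [← mul_assoc, h]

/-- The quantum determinant `ad - qbc` is multiplicative and the `GL_q(2)` relations are
stable under products of entrywise commuting matrices. -/
theorem GLq2Rel.mul {R A : Type} [CommRing R] [Ring A] [Algebra R A] {q : Rˣ}
    {a b c d a' b' c' d' : A} (h : GLq2Rel q a b c d) (h' : GLq2Rel q a' b' c' d')
    (hcomm : ∀ x ∈ ({a, b, c, d} : Set A), ∀ y ∈ ({a', b', c', d'} : Set A), Commute x y) :
    GLq2Rel q (a * a' + b * c') (a * b' + b * d') (c * a' + d * c') (c * b' + d * d') ∧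
      (a * a' + b * c') * (c * b' + d * d')
          - (q : R) • ((a * b' + b * d') * (c * a' + d * c')) =
        (a * d - (q : R) • (b * c)) * (a' * d' - (q : R) • (b' * c')) := by
  unfold GLq2Rel at *
  obtain ⟨h1, h2, h3, h4, h5, h6⟩ := h
  obtain ⟨k1, k2, k3, k4, k5, k6⟩ := h'
  simp only [Set.mem_insert_iff, Set.mem_singleton_iff, forall_eq_or_imp, forall_eq] at hcomm
  obtain ⟨⟨m1, m2, m3, m4⟩, ⟨m5, m6, m7, m8⟩, ⟨m9, m10, m11, m12⟩, m13, m14, m15, m16⟩ := hcomm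
  have e : (q : R) * ((q⁻¹ : Rˣ) : R) = 1 := by simp
  generalize (q : R) = s at *
  generalize ((q⁻¹ : Rˣ) : R) = p at *
  replace h6 := sub_eq_iff_eq_add.1 h6
  replace k6 := sub_eq_iff_eq_add.1 k6
  refine ⟨⟨?_, ?_, ?_, ?_, ?_, ?_⟩, ?_⟩
  all_goals
    simp only [
      mul_add, add_mul, mul_sub, sub_mul, mul_assoc, smul_mul_assoc, mul_smul_comm, h1, h2, h3,
      h4, h5, h6, k1, k2, k3, k4, k5, k6, mul_mul_eq_of_mul_eq h1, mul_mul_eq_of_mul_eq h2,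
      mul_mul_eq_of_mul_eq h3, mul_mul_eq_of_mul_eq h4, mul_mul_eq_of_mul_eq h5,
      mul_mul_eq_of_mul_eq h6, m1.symm.left_comm, m2.symm.left_comm, m3.symm.left_comm,
      m4.symm.left_comm, m5.symm.left_comm, m6.symm.left_comm, m7.symm.left_comm,
      m8.symm.left_comm, m9.symm.left_comm, m10.symm.left_comm, m11.symm.left_comm,
      m12.symm.left_comm, m13.symm.left_comm, m14.symm.left_comm, m15.symm.left_comm,
      m16.symm.left_comm] <;>
    match_scalars <;> clear * - e <;> grind

theorem GLq2Rel.commute_det {R A : Type} [CommRing R] [Ring A] [Algebra R A] {q : Rˣ}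
    {a b c d : A} (h : GLq2Rel q a b c d) :
    ∀ x ∈ ({a, b, c, d} : Set A), Commute (a * d - (q : R) • (b * c)) x := by
  obtain ⟨h1, h2, h3, h4, h5, h6⟩ := h
  have e : (q : R) * ((q⁻¹ : Rˣ) : R) = 1 := by simp
  generalize (q : R) = s at *
  generalize ((q⁻¹ : Rˣ) : R) = p at *
  replace h6 := sub_eq_iff_eq_add.1 h6
  simp only [Set.mem_insert_iff, Set.mem_singleton_iff, forall_eq_or_imp, forall_eq, Commute,
    SemiconjBy]
  refine ⟨?_, ?_, ?_, ?_⟩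
  all_goals
    simp only [
      mul_add, add_mul, mul_sub, sub_mul, mul_assoc, smul_mul_assoc, mul_smul_comm, h1, h2, h3,
      h4, h5, h6, mul_mul_eq_of_mul_eq h1, mul_mul_eq_of_mul_eq h2, mul_mul_eq_of_mul_eq h3,
      mul_mul_eq_of_mul_eq h4, mul_mul_eq_of_mul_eq h5, mul_mul_eq_of_mul_eq h6] <;>
    match_scalars <;> clear * - e <;> grind

theorem REREl.commute_integrals {R A : Type} [CommRing R] [Ring A] [Algebra R A] {q : Rˣ}
    {α β γ δ : A} (h : REREl q α β γ δ) :
    ∀ x ∈ ({α, β, γ, δ} : Set A), Commute (β - (q : R) • γ) x ∧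
      Commute (α * δ - ((q : R) ^ 2) • (β * γ)) x := by
  obtain ⟨h1, h2, h3, h4, h5, h6⟩ := h
  have e : (q : R) * ((q⁻¹ : Rˣ) : R) = 1 := by simp
  generalize (q : R) = s at *
  generalize ((q⁻¹ : Rˣ) : R) = p at *
  replace h1 := sub_eq_iff_eq_add.1 h1
  replace h3 := sub_eq_iff_eq_add.1 h3
  replace h5 := sub_eq_iff_eq_add.1 h5
  simp only [Set.mem_insert_iff, Set.mem_singleton_iff, forall_eq_or_imp, forall_eq, Commute,
    SemiconjBy]
  refine ⟨⟨?_, ?_⟩, ⟨?_, ?_⟩, ⟨?_, ?_⟩, ?_, ?_⟩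
  all_goals
    simp only [
      mul_add, add_mul, mul_sub, sub_mul, mul_assoc, smul_mul_assoc, mul_smul_comm, h1, h2, h3,
      h4, h5, h6, mul_mul_eq_of_mul_eq h1, mul_mul_eq_of_mul_eq h2, mul_mul_eq_of_mul_eq h3,
      mul_mul_eq_of_mul_eq h4, mul_mul_eq_of_mul_eq h5, mul_mul_eq_of_mul_eq h6] <;>
    match_scalars <;> clear * - e <;> grind

theorem REREl.integrals_coaction {R A : Type} [CommRing R] [Ring A] [Algebra R A] {q : Rˣ}
    {a b c d α β γ δ : A} (h : GLq2Rel q a b c d) (k : REREl q α β γ δ)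
    (hcomm : ∀ x ∈ ({a, b, c, d} : Set A), ∀ y ∈ ({α, β, γ, δ} : Set A), Commute x y) :
    ((a * α + b * γ) * c + (a * β + b * δ) * d)
        - (q : R) • ((c * α + d * γ) * a + (c * β + d * δ) * b) =
      (a * d - (q : R) • (b * c)) * (β - (q : R) • γ) ∧
    ((a * α + b * γ) * a + (a * β + b * δ) * b) * ((c * α + d * γ) * c + (c * β + d * δ) * d)
        - ((q : R) ^ 2) • (((a * α + b * γ) * c + (a * β + b * δ) * d) *
          ((c * α + d * γ) * a + (c * β + d * δ) * b)) =
      (a * d - (q : R) • (b * c)) ^ 2 * (α * δ - ((q : R) ^ 2) • (β * γ)) := by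
  obtain ⟨h1, h2, h3, h4, h5, h6⟩ := h
  obtain ⟨k1, k2, k3, k4, k5, k6⟩ := k
  simp only [Set.mem_insert_iff, Set.mem_singleton_iff, forall_eq_or_imp, forall_eq] at hcomm
  obtain ⟨⟨m1, m2, m3, m4⟩, ⟨m5, m6, m7, m8⟩, ⟨m9, m10, m11, m12⟩, m13, m14, m15, m16⟩ := hcomm
  have e : (q : R) * ((q⁻¹ : Rˣ) : R) = 1 := by simp
  generalize (q : R) = s at *
  generalize ((q⁻¹ : Rˣ) : R) = p at *
  replace h6 := sub_eq_iff_eq_add.1 h6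
  replace k1 := sub_eq_iff_eq_add.1 k1
  replace k3 := sub_eq_iff_eq_add.1 k3
  replace k5 := sub_eq_iff_eq_add.1 k5
  refine ⟨?_, ?_⟩
  all_goals
    simp only [
      pow_two, mul_add, add_mul, mul_sub, sub_mul, mul_assoc, smul_mul_assoc, mul_smul_comm,
      smul_add, smul_sub, h1, h2, h3, h4, h5, h6, k1, k2, k3, k4, k5, k6, mul_mul_eq_of_mul_eq h1,
      mul_mul_eq_of_mul_eq h2, mul_mul_eq_of_mul_eq h3, mul_mul_eq_of_mul_eq h4,
      mul_mul_eq_of_mul_eq h5, mul_mul_eq_of_mul_eq h6, m1.symm.eq, m2.symm.eq, m3.symm.eq,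
      m4.symm.eq, m5.symm.eq, m6.symm.eq, m7.symm.eq, m8.symm.eq, m9.symm.eq, m10.symm.eq,
      m11.symm.eq, m12.symm.eq, m13.symm.eq, m14.symm.eq, m15.symm.eq, m16.symm.eq,
      m1.symm.left_comm, m2.symm.left_comm, m3.symm.left_comm, m4.symm.left_comm,
      m5.symm.left_comm, m6.symm.left_comm, m7.symm.left_comm, m8.symm.left_comm,
      m9.symm.left_comm, m10.symm.left_comm, m11.symm.left_comm, m12.symm.left_comm,
      m13.symm.left_comm, m14.symm.left_comm, m15.symm.left_comm, m16.symm.left_comm] <;>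
    match_scalars <;> clear * - e <;> grind

theorem Matrix.commute_mul_apply {l m n A : Type*} [Fintype m] [Semiring A] {x : A}
    {M : Matrix l m A} {N : Matrix m n A} (hM : ∀ i j, Commute x (M i j))
    (hN : ∀ i j, Commute x (N i j)) (i : l) (j : n) : Commute x ((M * N) i j) := by
  rw [Matrix.mul_apply]
  exact Commute.sum_right _ _ _ fun k _ => (hM i k).mul_right (hN k j)

theorem Matrix.transpose_mul_of_commute {l m n A : Type*} [Fintype m] [Semiring A]
    {M : Matrix l m A} {N : Matrix m n A} (h : ∀ i j k r, Commute (M i j) (N k r)) :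
    (M * N).transpose = N.transpose * M.transpose := by
  ext i j
  simp only [Matrix.transpose_apply, Matrix.mul_apply]
  exact Finset.sum_congr rfl fun k _ => (h j k k i).eq

/-- The product `T_j ⋯ T_1`. -/
def TProd {A : Type} [Ring A] (a b c d : ℕ → A) : ℕ → Matrix (Fin 2) (Fin 2) A
  | 0 => 1
  | j + 1 => Tmat a b c d (j + 1) * TProd a b c d j

/-- The quantum determinant of a `2 × 2` matrix. -/
def qDet {R A : Type} [CommRing R] [Ring A] [Algebra R A] (q : R)
    (M : Matrix (Fin 2) (Fin 2) A) : A :=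
  M 0 0 * M 1 1 - q • (M 0 1 * M 1 0)

theorem commute_qDet {R A : Type} [CommRing R] [Ring A] [Algebra R A] {q : R}
    {M : Matrix (Fin 2) (Fin 2) A} {x : A} (h : ∀ i j, Commute x (M i j)) :
    Commute x (qDet q M) :=
  ((h 0 0).mul_right (h 1 1)).sub_right (((h 0 1).mul_right (h 1 0)).smul_right q)

theorem commute_TProd {A : Type} [Ring A] {a b c d : ℕ → A} {x : A} {j : ℕ}
    (h : ∀ l, 1 ≤ l → l ≤ j → ∀ i k, Commute x (Tmat a b c d l i k)) (i k : Fin 2) :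
    Commute x (TProd a b c d j i k) := by
  induction j generalizing i k with
  | zero =>
    rw [TProd, Matrix.one_apply]
    split_ifs
    exacts [Commute.one_right x, Commute.zero_right x]
  | succ j ih =>
    exact Matrix.commute_mul_apply (h (j + 1) (by lia) le_rfl)
      (ih fun l h1 hl => h l h1 (by lia)) i k

theorem commute_KIter {A : Type} [Ring A] {K : Matrix (Fin 2) (Fin 2) A} {a b c d : ℕ → A}
    {x : A} {j : ℕ} (hK : ∀ i k, Commute x (K i k))
    (h : ∀ l, 1 ≤ l → l ≤ j → ∀ i k, Commute x (Tmat a b c d l i k)) (i k : Fin 2) :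
    Commute x (KIter K a b c d j i k) := by
  induction j generalizing i k with
  | zero => exact hK i k
  | succ j ih =>
    have hT := h (j + 1) (by lia) le_rfl
    exact Matrix.commute_mul_apply
      (Matrix.commute_mul_apply hT (ih fun l h1 hl => h l h1 (by lia))) (fun i k => hT k i) i k

theorem commute_Tmat_TProd {A : Type} [Ring A] {a b c d : ℕ → A} {n : ℕ}
    (hTT : ∀ l l', 1 ≤ l → l ≤ n → 1 ≤ l' → l' ≤ n → l ≠ l' →
      ∀ i k i' k', Commute (Tmat a b c d l i k) (Tmat a b c d l' i' k'))
    {j : ℕ} (hj : j + 1 ≤ n) (i k i' k' : Fin 2) :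
    Commute (Tmat a b c d (j + 1) i k) (TProd a b c d j i' k') :=
  commute_TProd (fun l h1 hl => hTT _ l (by lia) hj h1 (by lia) (by lia) i k) i' k'

theorem KIter_eq {A : Type} [Ring A] (K : Matrix (Fin 2) (Fin 2) A) {a b c d : ℕ → A} {n : ℕ}
    (hTT : ∀ l l', 1 ≤ l → l ≤ n → 1 ≤ l' → l' ≤ n → l ≠ l' →
      ∀ i k i' k', Commute (Tmat a b c d l i k) (Tmat a b c d l' i' k'))
    {j : ℕ} (hj : j ≤ n) :
    KIter K a b c d j = TProd a b c d j * K * (TProd a b c d j).transpose := by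
  induction j with
  | zero => simp [KIter, TProd]
  | succ j ih =>
    rw [KIter, TProd, ih (by lia), Matrix.transpose_mul_of_commute (commute_Tmat_TProd hTT hj)]
    simp only [Matrix.mul_assoc]

theorem gLq2Rel_TProd {R A : Type} [CommRing R] [Ring A] [Algebra R A] {q : Rˣ}
    {a b c d : ℕ → A} {n : ℕ}
    (hT : ∀ l, 1 ≤ l → l ≤ n → GLq2Rel q (a l) (b l) (c l) (d l))
    (hTT : ∀ l l', 1 ≤ l → l ≤ n → 1 ≤ l' → l' ≤ n → l ≠ l' →
      ∀ i k i' k', Commute (Tmat a b c d l i k) (Tmat a b c d l' i' k'))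
    {j : ℕ} (hj : j ≤ n) :
    GLq2Rel q (TProd a b c d j 0 0) (TProd a b c d j 0 1) (TProd a b c d j 1 0)
        (TProd a b c d j 1 1) ∧
      ∀ l, 1 ≤ l → l ≤ n → ∀ i k,
        Commute (qDet (q : R) (TProd a b c d j)) (Tmat a b c d l i k) := by
  induction j with
  | zero => simp [TProd, GLq2Rel, qDet]
  | succ j ih =>
    obtain ⟨ih1, ih2⟩ := ih (by lia)
    have hcomm := commute_Tmat_TProd hTT hj
    have h1 := hT (j + 1) (by lia) hj
    obtain ⟨hrel, hdet⟩ := h1.mul ih1 (by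
      have := hcomm
      simp only [Fin.forall_fin_two, Tmat] at this
      simp only [Set.mem_insert_iff, Set.mem_singleton_iff, forall_eq_or_imp, forall_eq]
      simp at this
      tauto)
    have hmul : qDet (q : R) (TProd a b c d (j + 1)) =
        qDet (q : R) (Tmat a b c d (j + 1)) * qDet (q : R) (TProd a b c d j) := by
      simpa [qDet, TProd, Tmat, Matrix.mul_apply] using hdet
    refine ⟨by simpa [TProd, Tmat, Matrix.mul_apply] using hrel, fun l hl hl' i k => ?_⟩
    rw [hmul]
    refine Commute.mul_left ?_ (ih2 l hl hl' i k)
    by_cases hlj : l = j + 1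
    · subst hlj
      have := h1.commute_det
      simp only [Set.mem_insert_iff, Set.mem_singleton_iff, forall_eq_or_imp, forall_eq] at this
      obtain ⟨t1, t2, t3, t4⟩ := this
      fin_cases i <;> fin_cases k <;> simpa [qDet, Tmat]
    · exact (commute_qDet fun i' k' =>
        hTT l (j + 1) hl hl' (by lia) hj hlj i k i' k').symm

/-- Under the RE relations for `K` and the `GL_q(2)` relations for
each `T_l` (`1 ≤ l ≤ m-1`), with the appropriate mutual commutativity, the elements
`c1^(k) = β^(k) - q γ^(k)` and `c2^(k) = α^(k) δ^(k) - q² β^(k) γ^(k)` (`2 ≤ k ≤ m`)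
pairwise commute, each of them commutes with each entry of `K^(m)`, and hence every
element of the subalgebra generated by the entries of `K^(m)` commutes with all of
them. -/
theorem RE_integrals_in_involution {R A : Type} [CommRing R] [Ring A] [Algebra R A]
    (q : Rˣ) (m : ℕ) (hm : 2 ≤ m) (α β γ δ : A) (a b c d : ℕ → A)
    (hK : REREl q α β γ δ)
    (hT : ∀ l, 1 ≤ l → l ≤ m - 1 → GLq2Rel q (a l) (b l) (c l) (d l))
    (hTT : ∀ l l', 1 ≤ l → l ≤ m - 1 → 1 ≤ l' → l' ≤ m - 1 → l ≠ l' →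
      ∀ x ∈ ({a l, b l, c l, d l} : Set A), ∀ y ∈ ({a l', b l', c l', d l'} : Set A),
        Commute x y)
    (hTK : ∀ l, 1 ≤ l → l ≤ m - 1 →
      ∀ x ∈ ({a l, b l, c l, d l} : Set A), ∀ y ∈ ({α, β, γ, δ} : Set A),
        Commute x y)
    (c1 c2 : ℕ → A)
    (hc1 : ∀ k, 2 ≤ k → k ≤ m → c1 k =
      KIter !![α, β; γ, δ] a b c d (k - 1) 0 1
        - (q : R) • KIter !![α, β; γ, δ] a b c d (k - 1) 1 0)
    (hc2 : ∀ k, 2 ≤ k → k ≤ m → c2 k =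
      KIter !![α, β; γ, δ] a b c d (k - 1) 0 0 * KIter !![α, β; γ, δ] a b c d (k - 1) 1 1
        - ((q : R) ^ 2) •
          (KIter !![α, β; γ, δ] a b c d (k - 1) 0 1 *
            KIter !![α, β; γ, δ] a b c d (k - 1) 1 0)) :
    (∀ k p, 2 ≤ k → k ≤ m → 2 ≤ p → p ≤ m →
      Commute (c1 k) (c1 p) ∧ Commute (c2 k) (c2 p) ∧ Commute (c1 k) (c2 p)) ∧
    (∀ k, 2 ≤ k → k ≤ m → ∀ i j : Fin 2,
      Commute (c1 k) (KIter !![α, β; γ, δ] a b c d (m - 1) i j) ∧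
      Commute (c2 k) (KIter !![α, β; γ, δ] a b c d (m - 1) i j)) ∧
    (∀ x ∈ Algebra.adjoin R
        ({KIter !![α, β; γ, δ] a b c d (m - 1) 0 0,
          KIter !![α, β; γ, δ] a b c d (m - 1) 0 1,
          KIter !![α, β; γ, δ] a b c d (m - 1) 1 0,
          KIter !![α, β; γ, δ] a b c d (m - 1) 1 1} : Set A),
      ∀ k p, 2 ≤ k → k ≤ m → 2 ≤ p → p ≤ m →
        Commute x (c1 k) ∧ Commute x (c2 p)) := by
  have hTT' : ∀ l l', 1 ≤ l → l ≤ m - 1 → 1 ≤ l' → l' ≤ m - 1 → l ≠ l' →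
      ∀ i k i' k', Commute (Tmat a b c d l i k) (Tmat a b c d l' i' k') := by
    intro l l' h1 h2 h3 h4 h5 i k i' k'
    apply hTT l l' h1 h2 h3 h4 h5
    · fin_cases i <;> fin_cases k <;> simp [Tmat]
    · fin_cases i' <;> fin_cases k' <;> simp [Tmat]
  have mem_K : ∀ i k : Fin 2, !![α, β; γ, δ] i k ∈ ({α, β, γ, δ} : Set A) := by
    intro i k
    fin_cases i <;> fin_cases k <;> simp
  have hTK' : ∀ l, 1 ≤ l → l ≤ m - 1 → ∀ i k, ∀ y ∈ ({α, β, γ, δ} : Set A),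
      Commute (Tmat a b c d l i k) y := by
    intro l h1 h2 i k
    apply hTK l h1 h2
    fin_cases i <;> fin_cases k <;> simp [Tmat]
  have hPK : ∀ j, j ≤ m - 1 → ∀ y ∈ ({α, β, γ, δ} : Set A), ∀ i k,
      Commute y (TProd a b c d j i k) := fun j hj y hy =>
    commute_TProd fun l h1 hl i k => (hTK' l h1 (hl.trans hj) i k y hy).symm
  have key : ∀ k, 2 ≤ k → k ≤ m →
      c1 k = qDet (q : R) (TProd a b c d (k - 1)) * (β - (q : R) • γ) ∧
      c2 k = qDet (q : R) (TProd a b c d (k - 1)) ^ 2 *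
        (α * δ - ((q : R) ^ 2) • (β * γ)) := by
    intro k hk hkm
    have hj : k - 1 ≤ m - 1 := by lia
    obtain ⟨e1, e2⟩ := hK.integrals_coaction (gLq2Rel_TProd hT hTT' hj).1 (by
      intro x hx y hy
      have := hPK (k - 1) hj y hy
      simp only [Set.mem_insert_iff, Set.mem_singleton_iff] at hx
      rcases hx with rfl | rfl | rfl | rfl <;> exact (this _ _).symm)
    rw [hc1 k hk hkm, hc2 k hk hkm, KIter_eq _ hTT' hj]
    exact ⟨by simpa [qDet, Matrix.mul_apply] using e1, by simpa [qDet, Matrix.mul_apply] using e2⟩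
  have hcK : ∀ k, 2 ≤ k → k ≤ m → ∀ y ∈ ({α, β, γ, δ} : Set A),
      Commute (c1 k) y ∧ Commute (c2 k) y := by
    intro k hk hkm y hy
    obtain ⟨e1, e2⟩ := key k hk hkm
    have hD : Commute (qDet (q : R) (TProd a b c d (k - 1))) y :=
      (commute_qDet (hPK (k - 1) (by lia) y hy)).symm
    obtain ⟨t1, t2⟩ := hK.commute_integrals y hy
    rw [e1, e2]
    exact ⟨hD.mul_left t1, (hD.pow_left 2).mul_left t2⟩
  have hcT : ∀ k, 2 ≤ k → k ≤ m → ∀ l, 1 ≤ l → l ≤ m - 1 → ∀ i j,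
      Commute (c1 k) (Tmat a b c d l i j) ∧ Commute (c2 k) (Tmat a b c d l i j) := by
    intro k hk hkm l hl hlm i j
    obtain ⟨e1, e2⟩ := key k hk hkm
    have hD := (gLq2Rel_TProd hT hTT' (j := k - 1) (by lia)).2 l hl hlm i j
    have hy := hTK' l hl hlm i j
    have hα := (hy α (by simp)).symm
    have hβ := (hy β (by simp)).symm
    have hγ := (hy γ (by simp)).symm
    have hδ := (hy δ (by simp)).symm
    rw [e1, e2]
    exact ⟨hD.mul_left (hβ.sub_left (hγ.smul_left _)),
      (hD.pow_left 2).mul_left ((hα.mul_left hδ).sub_left ((hβ.mul_left hγ).smul_left _))⟩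
  have hc : ∀ k, 2 ≤ k → k ≤ m → ∀ n, n ≤ m - 1 → ∀ i j,
      Commute (c1 k) (KIter !![α, β; γ, δ] a b c d n i j) ∧
      Commute (c2 k) (KIter !![α, β; γ, δ] a b c d n i j) := fun k hk hkm n hn i j =>
    ⟨commute_KIter (fun i j => (hcK k hk hkm _ (mem_K i j)).1)
        (fun l h1 hl i j => (hcT k hk hkm l h1 (hl.trans hn) i j).1) i j,
      commute_KIter (fun i j => (hcK k hk hkm _ (mem_K i j)).2)
        (fun l h1 hl i j => (hcT k hk hkm l h1 (hl.trans hn) i j).2) i j⟩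
  refine ⟨fun k p hk hkm hp hpm => ?_, fun k hk hkm => hc k hk hkm _ le_rfl,
    fun x hx k p hk hkm hp hpm => ?_⟩
  · have h := hc k hk hkm (p - 1) (by lia)
    rw [hc1 p hp hpm, hc2 p hp hpm]
    exact ⟨(h 0 1).1.sub_right ((h 1 0).1.smul_right _),
      ((h 0 0).2.mul_right (h 1 1).2).sub_right (((h 0 1).2.mul_right (h 1 0).2).smul_right _),
      ((h 0 0).1.mul_right (h 1 1).1).sub_right (((h 0 1).1.mul_right (h 1 0).1).smul_right _)⟩
  · have hk' := hc k hk hkm _ le_rfl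
    have hp' := hc p hp hpm _ le_rfl
    induction hx using Algebra.adjoin_induction with
    | mem x hx =>
      simp only [Set.mem_insert_iff, Set.mem_singleton_iff] at hx
      rcases hx with rfl | rfl | rfl | rfl <;> exact ⟨(hk' _ _).1.symm, (hp' _ _).2.symm⟩
    | algebraMap r => exact ⟨Algebra.commutes r _, Algebra.commutes r _⟩
    | add x y _ _ hx hy => exact ⟨hx.1.add_left hy.1, hx.2.add_left hy.2⟩
    | mul x y _ _ hx hy => exact ⟨hx.1.mul_left hy.1, hx.2.mul_left hy.2⟩
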